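/- arXiv:1110.0405 — 2 statements merged into one kernel-verified Lean document; each statement's English description precedes it below -/
import Mathlib

section
/- The classifying space Bℤ = |B_•ℤ| of the discrete group ℤ is homotopy equivalent to the circle S¹ (the unit circle in ℂ). -/
/-!
STATEMENT 3: The classifying space `Bℤ = |B_•ℤ|` of the discrete group `ℤ` is
homotopy equivalent to the circle `S¹` (the unit circle in `ℂ`).

As in Statement 2, the classifying simplicial set `B_•G` (`B_nG = Gⁿ`, with the
standard faces and degeneracies) is modelled as the nerve of the one-object
groupoid `SingleObj G`, and `BG` is its geometric realization.  The group `ℤ` is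
written multiplicatively as `Multiplicative ℤ`, and the circle is `Circle`, the
unit circle in `ℂ`.
-/

open CategoryTheory

/-- The classifying simplicial set `B_•G` of a (discrete) group `G`. -/
noncomputable def BSSet (G : Type) [Group G] : SSet := nerve (SingleObj G)

/-- The classifying space `BG := |B_•G|` of a discrete group `G`. -/
noncomputable def BSpace (G : Type) [Group G] : TopCat := SSet.toTop.obj (BSSet G)

open Simplicial Opposite unitInterval

namespace IntClassifyingSpace

/-- The simplex of `B_•ℤ` whose edge from `i` to `j` is `v j - v i`. -/
def simplex {n : ℕ} (v : Fin (n + 1) → ℤ) :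
    ComposableArrows (SingleObj (Multiplicative ℤ)) n where
  obj _ := SingleObj.star _
  map {i j} _ := Multiplicative.ofAdd (v j - v i)
  map_id i := congrArg Multiplicative.ofAdd (sub_self (v i))
  map_comp f g := by
    rw [SingleObj.comp_as_mul, ← ofAdd_add]; simp

lemma simplex_add_const {n : ℕ} (v : Fin (n + 1) → ℤ) (a : ℤ) :
    simplex (fun i ↦ v i + a) = simplex v := by
  refine CategoryTheory.Functor.ext (fun _ ↦ rfl) fun i j f ↦ ?_
  simp [simplex]

/-- The vertex labels of a simplex of `B_•ℤ`, normalized to be `0` at the first vertex. -/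
def potential {n : ℕ} (y : ComposableArrows (SingleObj (Multiplicative ℤ)) n) (i : Fin (n + 1)) :
    ℤ :=
  Multiplicative.toAdd (y.map (homOfLE (Fin.zero_le i)) : Multiplicative ℤ)

lemma simplex_potential {n : ℕ} (y : ComposableArrows (SingleObj (Multiplicative ℤ)) n) :
    simplex (potential y) = y := by
  refine CategoryTheory.Functor.ext (fun _ ↦ rfl) fun i j f ↦ ?_
  have h : y.map (homOfLE (Fin.zero_le j)) = y.map (homOfLE (Fin.zero_le i)) ≫ y.map f :=
    y.map_comp (homOfLE (Fin.zero_le i)) f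
  rw [SingleObj.comp_as_mul] at h
  have h' := congrArg Multiplicative.toAdd h
  rw [toAdd_mul] at h'
  simp only [eqToHom_refl, Category.comp_id, Category.id_comp]
  exact congrArg Multiplicative.ofAdd (sub_eq_of_eq_add h')

/-- The characteristic map of the simplex `simplex v` in `Bℤ`. -/
noncomputable def char {n : ℕ} (v : Fin (n + 1) → ℤ) :
    C(stdSimplex ℝ (Fin (n + 1)), BSpace (Multiplicative ℤ)) :=
  TopCat.toSSetObjEquiv _ (op ⦋n⦌)
    ((sSetTopAdj.unit.app (BSSet (Multiplicative ℤ))).app (op ⦋n⦌) (simplex v))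

lemma char_add_const {n : ℕ} (v : Fin (n + 1) → ℤ) (a : ℤ) :
    char (fun i ↦ v i + a) = char v := by
  simp only [char, simplex_add_const]

lemma char_map {k n : ℕ} (v : Fin (n + 1) → ℤ) (α : ⦋k⦌ ⟶ ⦋n⦌)
    (t : stdSimplex ℝ (Fin (k + 1))) :
    char v (stdSimplex.map α t) = char (v ∘ α) t := by
  have h := ConcreteCategory.congr_hom
    ((sSetTopAdj.unit.app (BSSet (Multiplicative ℤ))).naturality α.op) (simplex v)
  exact (congrArg (fun s ↦ TopCat.toSSetObjEquiv _ (op ⦋k⦌) s t) h).symm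

lemma hom_ext {T : Type} [TopologicalSpace T] {f g : C(BSpace (Multiplicative ℤ), T)}
    (h : ∀ n (v : Fin (n + 1) → ℤ) t, f (char v t) = g (char v t)) : f = g := by
  have : TopCat.ofHom f = TopCat.ofHom g := by
    apply (sSetTopAdj.homEquiv (BSSet (Multiplicative ℤ)) (TopCat.of T)).injective
    ext n y
    obtain ⟨v, rfl⟩ : ∃ v, simplex v = y := ⟨_, simplex_potential y⟩
    apply (TopCat.toSSetObjEquiv _ _).injective
    ext t
    exact h _ v t
  exact congrArg TopCat.Hom.hom this

lemma exists_desc {T : Type} [TopologicalSpace T]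
    (φ : ∀ n, (Fin (n + 1) → ℤ) → C(stdSimplex ℝ (Fin (n + 1)), T))
    (hφ : ∀ n (v : Fin (n + 1) → ℤ) a, φ n (fun i ↦ v i + a) = φ n v)
    (hφ' : ∀ k n (v : Fin (n + 1) → ℤ) (α : ⦋k⦌ ⟶ ⦋n⦌) t,
      φ n v (stdSimplex.map α t) = φ k (v ∘ α) t) :
    ∃ f : C(BSpace (Multiplicative ℤ), T),
      ∀ n (v : Fin (n + 1) → ℤ) t, f (char v t) = φ n v t := by
  let F : BSSet (Multiplicative ℤ) ⟶ TopCat.toSSet.obj (TopCat.of T) :=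
    { app := fun n ↦ ↾fun y ↦ (TopCat.toSSetObjEquiv (TopCat.of T) n).symm
        (φ n.unop.len (potential y))
      naturality := by
        intro n k α
        ext y
        obtain ⟨v, rfl⟩ : ∃ v, simplex v = y := ⟨_, simplex_potential y⟩
        apply (TopCat.toSSetObjEquiv _ _).injective
        ext t
        have h := DFunLike.congr_fun (hφ k.unop.len (v ∘ α.unop) (-(v ∘ α.unop) 0)) t
        have h' := hφ' k.unop.len n.unop.len v α.unop t
        refine (h.trans h'.symm).trans ?_
        rw [← hφ n.unop.len v (-v 0)]
        rfl }
  refine ⟨((sSetTopAdj.homEquiv _ _).symm F).hom, fun n v t ↦ ?_⟩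
  have h := (sSetTopAdj.homEquiv (BSSet (Multiplicative ℤ)) (TopCat.of T)).apply_symm_apply F
  have h' := ConcreteCategory.congr_hom (NatTrans.congr_app h (op ⦋n⦌)) (simplex v)
  refine (congrArg (fun s ↦ TopCat.toSSetObjEquiv _ (op ⦋n⦌) s t) h').trans ?_
  exact DFunLike.congr_fun (hφ n v (-v 0)) t

section Weights

variable {ι κ : Type} [Fintype ι] [Fintype κ]

lemma sum_map_mul (f : ι → κ) (t : stdSimplex ℝ ι) (g : κ → ℝ) :
    ∑ j, stdSimplex.map f t j * g j = ∑ i, t i * g (f i) := by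
  classical
  simp only [stdSimplex.map_coe, FunOnFinite.linearMap_apply_apply, Finset.sum_mul]
  rw [← Finset.sum_fiberwise Finset.univ f]
  refine Finset.sum_congr rfl fun j _ ↦ Finset.sum_congr rfl fun i hi ↦ ?_
  rw [(Finset.mem_filter.1 hi).2]

lemma eq_map_of_sum_mul {f : ι → κ} {t : stdSimplex ℝ ι} {u : stdSimplex ℝ κ}
    (h : ∀ g : κ → ℝ, ∑ j, u j * g j = ∑ i, t i * g (f i)) : u = stdSimplex.map f t := by
  classical
  ext j
  have := (h (Pi.single j 1)).trans (sum_map_mul f t (Pi.single j 1)).symm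
  simpa [Pi.single_apply] using this

end Weights

/-- The affine extension to a simplex of a labelling of its vertices. -/
def height {n : ℕ} (v : Fin (n + 1) → ℤ) (t : stdSimplex ℝ (Fin (n + 1))) : ℝ :=
  ∑ i, t i * v i

@[fun_prop]
lemma continuous_coord {n : ℕ} (i : Fin n) :
    Continuous fun t : stdSimplex ℝ (Fin n) ↦ t i :=
  (continuous_apply i).comp continuous_subtype_val

lemma continuous_coord_fst {n : ℕ} {X : Type*} [TopologicalSpace X] (i : Fin n) :
    Continuous fun q : stdSimplex ℝ (Fin n) × X ↦ q.1 i :=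
  (continuous_coord i).comp continuous_fst

lemma continuous_height {n : ℕ} (v : Fin (n + 1) → ℤ) : Continuous (height v) := by
  unfold height; fun_prop

lemma height_add_const {n : ℕ} (v : Fin (n + 1) → ℤ) (a : ℤ) (t : stdSimplex ℝ (Fin (n + 1))) :
    height (fun i ↦ v i + a) t = height v t + a := by
  simp [height, mul_add, Finset.sum_add_distrib, ← Finset.sum_mul]

lemma height_map {k n : ℕ} (v : Fin (n + 1) → ℤ) (α : Fin (k + 1) → Fin (n + 1))
    (t : stdSimplex ℝ (Fin (k + 1))) :
    height v (stdSimplex.map α t) = height (v ∘ α) t :=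
  sum_map_mul α t fun i ↦ (v i : ℝ)

/-- The point dividing the segment from the new vertex `0` to `t` in the ratio `1 - s : s`. -/
def cone {n : ℕ} (s : I) (t : stdSimplex ℝ (Fin (n + 1))) : stdSimplex ℝ (Fin (n + 2)) :=
  ⟨Fin.cons (s : ℝ) fun i ↦ (1 - s) * t i, by
    refine ⟨Fin.cases s.2.1 fun i ↦ mul_nonneg (sub_nonneg.2 s.2.2) (t.2.1 i), ?_⟩
    simp [Fin.sum_univ_succ (n := n + 1), ← Finset.mul_sum]⟩

/-- The point of the `1`-simplex with barycentric coordinates `(1 - θ, θ)`. -/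
def edge (θ : I) : stdSimplex ℝ (Fin 2) :=
  ⟨![1 - θ, θ], by
    refine ⟨Fin.forall_fin_two.2 ⟨sub_nonneg.2 θ.2.2, θ.2.1⟩, ?_⟩
    simp⟩

/-- The point dividing the segment from `t` to the point `edge θ` of a new edge spanned by the
vertices `0` and `1` in the ratio `s : 1 - s`. -/
def join {n : ℕ} (s θ : I) (t : stdSimplex ℝ (Fin (n + 1))) : stdSimplex ℝ (Fin (n + 3)) :=
  ⟨Fin.cons (s * (1 - θ) : ℝ) (Fin.cons (s * θ : ℝ) fun i ↦ (1 - s) * t i), by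
    refine ⟨Fin.cases (mul_nonneg s.2.1 (sub_nonneg.2 θ.2.2)) (Fin.cases (mul_nonneg s.2.1 θ.2.1)
      fun i ↦ mul_nonneg (sub_nonneg.2 s.2.2) (t.2.1 i)), ?_⟩
    simp only [Fin.sum_univ_succ (n := n + 2), Fin.sum_univ_succ (n := n + 1), Fin.cons_zero,
      Fin.cons_succ, ← Finset.mul_sum, stdSimplex.sum_eq_one]
    ring⟩

lemma sum_cone_mul {n : ℕ} (s : I) (t : stdSimplex ℝ (Fin (n + 1))) (g : Fin (n + 2) → ℝ) :
    ∑ i, cone s t i * g i = s * g 0 + (1 - s) * ∑ i, t i * g i.succ := by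
  rw [Fin.sum_univ_succ, Finset.mul_sum]
  simp_rw [← mul_assoc]
  rfl

lemma sum_edge_mul (θ : I) (g : Fin 2 → ℝ) :
    ∑ i, edge θ i * g i = (1 - θ) * g 0 + θ * g 1 := by
  rw [Fin.sum_univ_two]
  rfl

lemma sum_join_mul {n : ℕ} (s θ : I) (t : stdSimplex ℝ (Fin (n + 1))) (g : Fin (n + 3) → ℝ) :
    ∑ i, join s θ t i * g i =
      s * (1 - θ) * g 0 + (s * θ * g 1 + (1 - s) * ∑ i, t i * g i.succ.succ) := by
  rw [Fin.sum_univ_succ, Fin.sum_univ_succ, Finset.mul_sum]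
  simp_rw [← mul_assoc]
  rfl

lemma continuous_join {n : ℕ} :
    Continuous fun q : stdSimplex ℝ (Fin (n + 1)) × I × I ↦ join q.2.1 q.2.2 q.1 := by
  refine Continuous.subtype_mk (continuous_pi (Fin.cases ?_ (Fin.cases ?_ fun i ↦ ?_))) _
  · simp only [Fin.cons_zero]; fun_prop
  · simp only [Fin.cons_succ, Fin.cons_zero]; fun_prop
  · simp only [Fin.cons_succ]
    exact Continuous.mul (by fun_prop) (continuous_coord_fst i)

/-- The labelling obtained by adjoining two initial vertices with labels `m` and `m + 1`. -/
def extend {n : ℕ} (m : ℤ) (v : Fin (n + 1) → ℤ) : Fin (n + 3) → ℤ :=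
  Fin.cons m (Fin.cons (m + 1) v)

lemma char_extend_join_zero {n : ℕ} (m : ℤ) (v : Fin (n + 1) → ℤ) (s : I)
    (t : stdSimplex ℝ (Fin (n + 1))) :
    char (extend m v) (join s 0 t) = char (Fin.cons m v : Fin (n + 2) → ℤ) (cone s t) := by
  have h : join s 0 t = stdSimplex.map (SimplexCategory.δ (n := n + 1) 1) (cone s t) := by
    refine eq_map_of_sum_mul fun g ↦ ?_
    rw [sum_join_mul, sum_cone_mul _ _ fun i ↦ g (SimplexCategory.δ (n := n + 1) 1 i)]
    simp
    rfl
  rw [h, char_map]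
  congr 2
  funext i
  refine Fin.cases rfl (fun i ↦ rfl) i

lemma char_extend_join_one {n : ℕ} (m : ℤ) (v : Fin (n + 1) → ℤ) (s : I)
    (t : stdSimplex ℝ (Fin (n + 1))) :
    char (extend m v) (join s 1 t) = char (Fin.cons (m + 1) v : Fin (n + 2) → ℤ) (cone s t) := by
  have h : join s 1 t = stdSimplex.map (SimplexCategory.δ (n := n + 1) 0) (cone s t) := by
    refine eq_map_of_sum_mul fun g ↦ ?_
    rw [sum_join_mul, sum_cone_mul _ _ fun i ↦ g (SimplexCategory.δ (n := n + 1) 0 i)]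
    simp
    rfl
  rw [h, char_map]
  congr 2

lemma char_extend_join_left {n : ℕ} (m : ℤ) (v : Fin (n + 1) → ℤ) (θ : I)
    (t : stdSimplex ℝ (Fin (n + 1))) :
    char (extend m v) (join 0 θ t) = char v t := by
  let α : ⦋n⦌ ⟶ ⦋n + 2⦌ := SimplexCategory.δ 0 ≫ SimplexCategory.δ 0
  have h : join 0 θ t = stdSimplex.map α t := by
    refine eq_map_of_sum_mul fun g ↦ ?_
    rw [sum_join_mul]
    simp
    rfl
  rw [h, char_map]
  congr 2

lemma char_extend_join_right {n : ℕ} (m : ℤ) (v : Fin (n + 1) → ℤ) (θ : I)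
    (t : stdSimplex ℝ (Fin (n + 1))) :
    char (extend m v) (join 1 θ t) = char ![0, 1] (edge θ) := by
  let α : ⦋1⦌ ⟶ ⦋n + 2⦌ := SimplexCategory.mkHom
    ⟨![0, 1], by intro i j; fin_cases i <;> fin_cases j <;> simp⟩
  have h : join 1 θ t = stdSimplex.map α (edge θ) := by
    refine eq_map_of_sum_mul fun g ↦ ?_
    rw [sum_join_mul, sum_edge_mul _ fun i ↦ g (α i)]
    simp
    rfl
  rw [h, char_map, ← char_add_const ![0, 1] m]
  congr 2
  funext i
  fin_cases i
  · exact (zero_add m).symm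
  · exact add_comm m 1

lemma char_extend_join_map {k n : ℕ} (m : ℤ) (v : Fin (n + 1) → ℤ) (s θ : I) (α : ⦋k⦌ ⟶ ⦋n⦌)
    (t : stdSimplex ℝ (Fin (k + 1))) :
    char (extend m v) (join s θ (stdSimplex.map α t)) = char (extend m (v ∘ α)) (join s θ t) := by
  let β : ⦋k + 2⦌ ⟶ ⦋n + 2⦌ := SimplexCategory.mkHom
    ⟨Fin.cons 0 (Fin.cons 1 fun i ↦ (α i).succ.succ), by
      refine Fin.monotone_iff_le_succ.2 (Fin.cases ?_ (Fin.cases ?_ fun i ↦ ?_))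
      · exact Fin.zero_le _
      · change (1 : Fin (n + 3)) ≤ (α 0).succ.succ
        simp [Fin.le_def]
      · change (α i.castSucc).succ.succ ≤ (α i.succ).succ.succ
        exact Fin.succ_le_succ_iff.2 <| Fin.succ_le_succ_iff.2 <|
          α.toOrderHom.monotone i.castSucc_lt_succ.le⟩
  have h : join s θ (stdSimplex.map α t) = stdSimplex.map β (join s θ t) := by
    refine eq_map_of_sum_mul fun g ↦ ?_
    rw [sum_join_mul, sum_join_mul _ _ _ fun i ↦ g (β i),
      sum_map_mul _ _ fun i : Fin (n + 1) ↦ g i.succ.succ]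
    rfl
  rw [h, char_map]
  congr 2
  funext i
  exact Fin.cases rfl (Fin.cases rfl fun i ↦ rfl) i

lemma extend_add_const {n : ℕ} (m a : ℤ) (v : Fin (n + 1) → ℤ) :
    extend (m + a) (fun i ↦ v i + a) = fun i ↦ extend m v i + a := by
  funext i
  refine Fin.cases rfl (Fin.cases ?_ fun i ↦ rfl) i
  exact add_right_comm m a 1

/-- The fractional part of a real number, as a point of the unit interval. -/
noncomputable def fractI (x : ℝ) : I := ⟨Int.fract x, Int.fract_nonneg x, (Int.fract_lt_one x).le⟩

/-- The point dividing in the ratio `s : 1 - s` the segment from the point `t` of the simplex with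
vertex labels `v` to the point `x` of the real line. -/
noncomputable def segment {n : ℕ} (v : Fin (n + 1) → ℤ)
    (q : stdSimplex ℝ (Fin (n + 1)) × I × ℝ) : BSpace (Multiplicative ℤ) :=
  char (extend ⌊q.2.2⌋ v) (join q.2.1 (fractI q.2.2) q.1)

lemma segment_eq {n : ℕ} (v : Fin (n + 1) → ℤ) (q : stdSimplex ℝ (Fin (n + 1)) × I × ℝ) (m : ℤ)
    (hm : q.2.2 ∈ Set.Icc (m : ℝ) (m + 1)) :
    segment v q =
      char (extend m v) (join q.2.1 (Set.projIcc 0 1 zero_le_one (q.2.2 - m)) q.1) := by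
  obtain ⟨t, s, x⟩ := q
  dsimp only [segment] at hm ⊢
  rcases hm.2.eq_or_lt with h | h
  · have h1 : ⌊x⌋ = m + 1 := by rw [h]; exact_mod_cast Int.floor_intCast (m + 1)
    have h2 : fractI x = 0 := Subtype.ext <| by simp [fractI, h]
    have h3 : Set.projIcc (0 : ℝ) 1 zero_le_one (x - m) = 1 := by
      rw [h]; simp
    rw [h1, h2, h3, char_extend_join_zero, char_extend_join_one]
  · have h1 : ⌊x⌋ = m := Int.floor_eq_iff.2 ⟨hm.1, h⟩
    have h2 : Set.projIcc 0 1 zero_le_one (x - m) = fractI x := by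
      rw [Set.projIcc_of_mem _ ⟨sub_nonneg.2 hm.1, by linarith⟩]
      exact Subtype.ext (by simp [fractI, Int.fract, h1])
    rw [h1, h2]

lemma continuous_segment {n : ℕ} (v : Fin (n + 1) → ℤ) : Continuous (segment v) := by
  have hx : Continuous fun q : stdSimplex ℝ (Fin (n + 1)) × I × ℝ ↦ q.2.2 := by fun_prop
  have hfin : LocallyFinite fun m : ℤ ↦ Set.Icc (m : ℝ) (m + 1) :=
    locallyFinite_Icc_of_tendsto tendsto_intCast_atTop_atTop
      (Filter.tendsto_atBot_add_const_right _ _ (tendsto_intCast_atBot_iff.2 Filter.tendsto_id))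
  refine (hfin.preimage_continuous hx).continuous ?_ (fun m ↦ isClosed_Icc.preimage hx) fun m ↦ ?_
  · refine Set.eq_univ_of_forall fun q ↦ Set.mem_iUnion.2 ⟨⌊q.2.2⌋, ?_⟩
    exact ⟨Int.floor_le _, (Int.lt_floor_add_one _).le⟩
  · refine ContinuousOn.congr (Continuous.continuousOn ?_) fun q hq ↦ segment_eq v q m hq
    have h : Continuous fun q : stdSimplex ℝ (Fin (n + 1)) × I × ℝ ↦
        ((q.1, q.2.1, Set.projIcc 0 1 zero_le_one (q.2.2 - m)) :
          stdSimplex ℝ (Fin (n + 1)) × I × I) :=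
      continuous_fst.prodMk ((continuous_fst.comp continuous_snd).prodMk
        (continuous_projIcc.comp (hx.sub continuous_const)))
    exact (char _).continuous.comp (continuous_join.comp h)

/-- The universal cover of the loop in `Bℤ` given by the generator of `ℤ`. -/
noncomputable def line (x : ℝ) : BSpace (Multiplicative ℤ) := char ![0, 1] (edge (fractI x))

lemma segment_one {n : ℕ} (v : Fin (n + 1) → ℤ) (t : stdSimplex ℝ (Fin (n + 1))) (x : ℝ) :
    segment v (t, 1, x) = line x :=
  char_extend_join_right _ _ _ _

lemma continuous_line : Continuous line := by
  have h : line = fun x ↦ segment (n := 0) 0 (default, 1, x) :=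
    funext fun x ↦ (segment_one _ _ x).symm
  rw [h]
  exact (continuous_segment _).comp (by fun_prop)

lemma line_periodic : Function.Periodic line 1 := fun x ↦ by
  simp [line, fractI]

/-- The loop in `Bℤ` given by the generator of `ℤ`. -/
noncomputable def loop : C(AddCircle (1 : ℝ), BSpace (Multiplicative ℤ)) where
  toFun := line_periodic.lift
  continuous_toFun := continuous_line.quotient_lift _

lemma coe_intCast (a : ℤ) : ((a : ℝ) : AddCircle (1 : ℝ)) = 0 :=
  (AddCircle.coe_eq_zero_iff 1).2 ⟨a, by simp⟩

lemma exists_winding : ∃ f : C(BSpace (Multiplicative ℤ), AddCircle (1 : ℝ)),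
    ∀ n (v : Fin (n + 1) → ℤ) t, f (char v t) = (height v t : AddCircle (1 : ℝ)) := by
  refine exists_desc (fun n v ↦ ⟨fun t ↦ (height v t : AddCircle (1 : ℝ)),
    (AddCircle.continuous_mk' 1).comp (continuous_height v)⟩) ?_ ?_
  · intro n v a
    ext t
    change ((height _ t : ℝ) : AddCircle (1 : ℝ)) = (height v t : ℝ)
    rw [height_add_const, AddCircle.coe_add, coe_intCast, add_zero]
  · intro k n v α t
    exact congrArg _ (height_map v α t)

lemma exists_homotopy : ∃ f : C(BSpace (Multiplicative ℤ), C(I, BSpace (Multiplicative ℤ))),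
    ∀ n (v : Fin (n + 1) → ℤ) t s, f (char v t) s = segment v (t, s, height v t) := by
  refine (exists_desc (fun n v ↦ ContinuousMap.curry
    ⟨fun q ↦ segment v (q.1, q.2, height v q.1), (continuous_segment v).comp <|
      continuous_fst.prodMk <| continuous_snd.prodMk <|
        (continuous_height v).comp continuous_fst⟩) ?_ ?_).imp fun f hf n v t s ↦ by rw [hf]; rfl
  · intro n v a
    ext t s
    have h : fractI (height v t + a) = fractI (height v t) := Subtype.ext (by simp [fractI])
    simp only [ContinuousMap.curry_apply, ContinuousMap.coe_mk, segment, height_add_const,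
      Int.floor_add_intCast, extend_add_const, char_add_const, h]
  · intro k n v α t
    ext s
    simp only [ContinuousMap.curry_apply, ContinuousMap.coe_mk, segment, height_map,
      char_extend_join_map]

end IntClassifyingSpace

open IntClassifyingSpace in
/-- **`Bℤ` is homotopy equivalent to the circle `S¹ ⊆ ℂ`.** -/
theorem classifyingSpace_int_homotopyEquiv_circle :
    Nonempty (ContinuousMap.HomotopyEquiv (BSpace (Multiplicative ℤ)) Circle) := by
  obtain ⟨f, hf⟩ := exists_winding
  obtain ⟨h, hh⟩ := exists_homotopy
  have hfl : f.comp loop = ContinuousMap.id _ := by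
    ext x
    obtain ⟨x, rfl⟩ := QuotientAddGroup.mk_surjective x
    have h1 : height ![0, 1] (edge (fractI x)) = Int.fract x := by
      rw [height, sum_edge_mul _ fun i ↦ ((![0, 1] i : ℤ) : ℝ)]
      simp [fractI]
    have h2 : ((Int.fract x : ℝ) : AddCircle (1 : ℝ)) = x := by
      rw [← Int.self_sub_floor, AddCircle.coe_sub, coe_intCast, sub_zero]
    exact ((hf 1 ![0, 1] (edge (fractI x))).trans (congrArg _ h1)).trans h2
  let evalAt (s : I) : C(C(I, BSpace (Multiplicative ℤ)), BSpace (Multiplicative ℤ)) :=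
    ⟨fun p ↦ p s, by fun_prop⟩
  have hlf : (ContinuousMap.id _).Homotopic (loop.comp f) := by
    refine ⟨⟨⟨fun q ↦ h q.2 q.1, by fun_prop⟩, fun x ↦ ?_, fun x ↦ ?_⟩⟩
    · refine DFunLike.congr_fun (f := (evalAt 0).comp h) (g := .id _) (hom_ext fun n v t ↦ ?_) x
      exact (hh n v t 0).trans (char_extend_join_left _ _ _ _)
    · refine DFunLike.congr_fun (f := (evalAt 1).comp h) (g := loop.comp f)
        (hom_ext fun n v t ↦ ?_) x
      refine (hh n v t 1).trans ((segment_one _ _ _).trans ?_)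
      exact congrArg loop (hf n v t).symm
  exact ⟨(⟨f, loop, hlf.symm, hfl ▸ .refl _⟩ :
    ContinuousMap.HomotopyEquiv (BSpace (Multiplicative ℤ)) (AddCircle (1 : ℝ))).trans
      (AddCircle.homeomorphCircle one_ne_zero).toHomotopyEquiv⟩
end

section
/- Let G be a discrete group and z an element of the center of G. Define t_n: Gⁿ → Gⁿ by t_n(g₁, …, g_n) = (z(g₁g₂⋯g_n)^{−1}, g₁, …, g_{n−1}). Then together with the face and degeneracy maps of B_•G these operators satisfy the cyclic relations: t_n^{n+1} = id; d_i t_n = t_{n−1} d_{i−1} for 1 ≤ i ≤ n; d₀ t_n = d_n; s_i t_n = t_{n+1} s_{i−1} for 1 ≤ i ≤ n; and s₀ t_n = t_{n+1}² s_n. (Thus B_•G is a cyclic set.) -/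
/-!
STATEMENT 15: Let `G` be a discrete group and `z` an element of the center of `G`.
Define `t_n : Gⁿ → Gⁿ` by `t_n (g₁, …, g_n) = (z (g₁ g₂ ⋯ g_n)⁻¹, g₁, …, g_{n-1})`.
Together with the face and degeneracy maps of `B_•G` these satisfy the cyclic
relations:
`t_n^{n+1} = id`; `d_i t_n = t_{n-1} d_{i-1}` for `1 ≤ i ≤ n`; `d₀ t_n = d_n`;
`s_i t_n = t_{n+1} s_{i-1}` for `1 ≤ i ≤ n`; `s₀ t_n = t_{n+1}² s_n`.
(Thus `B_•G` is a cyclic set.)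

We model `B_n G = Gⁿ` as `Fin n → G`, written `0`-indexed: the tuple
`(g₁, …, g_n)` is the function `g` with `g ⟨k⟩ = g_{k+1}`.
-/

variable {G : Type*} [Group G]

/-- `B_n G`: the set of `n`-simplices `Gⁿ` of the classifying simplicial set. -/
abbrev BSimp (G : Type*) (n : ℕ) : Type _ := Fin n → G

/-- The face maps of `B_•G`, here written as maps `d_i : B_{n+1}G → B_nG`
for `i : Fin (n+2)`:
`d₀(g₁,…,g_{n+1}) = (g₂,…,g_{n+1})`,
`d_i(g₁,…,g_{n+1}) = (g₁,…,g_i g_{i+1},…,g_{n+1})` for `1 ≤ i ≤ n`, and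
`d_{n+1}(g₁,…,g_{n+1}) = (g₁,…,g_n)`. -/
def bFace (n : ℕ) (i : Fin (n + 2)) (g : BSimp G (n + 1)) : BSimp G n := fun k =>
  if (i : ℕ) = 0 then g k.succ
  else if (k : ℕ) + 1 < (i : ℕ) then g k.castSucc
  else if (k : ℕ) + 1 = (i : ℕ) then g k.castSucc * g k.succ
  else g k.succ

/-- The degeneracy maps of `B_•G`, `s_j : B_nG → B_{n+1}G` for `j : Fin (n+1)`:
`s_j(g₁,…,g_n) = (g₁,…,g_j, 1, g_{j+1},…,g_n)`. -/
def bDegen (n : ℕ) (j : Fin (n + 1)) (g : BSimp G n) : BSimp G (n + 1) := fun k =>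
  if h : (k : ℕ) < (j : ℕ) then g ⟨k, by omega⟩
  else if h2 : (k : ℕ) = (j : ℕ) then 1
  else g ⟨(k : ℕ) - 1, by omega⟩

/-- The cyclic operator `t_n : B_nG → B_nG` associated with a central element `z`:
`t_n (g₁, …, g_n) = (z (g₁ g₂ ⋯ g_n)⁻¹, g₁, …, g_{n-1})`. -/
def bCyc (z : G) (n : ℕ) (g : BSimp G n) : BSimp G n := fun k =>
  if h : (k : ℕ) = 0 then z * ((List.ofFn g).prod)⁻¹
  else g ⟨(k : ℕ) - 1, by omega⟩

lemma bCyc_zero (z : G) (n : ℕ) (g : BSimp G (n + 1)) :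
    bCyc z (n + 1) g 0 = z * (List.ofFn g).prod⁻¹ := rfl

lemma bCyc_succ (z : G) (n : ℕ) (g : BSimp G (n + 1)) (k : Fin n) :
    bCyc z (n + 1) g k.succ = g k.castSucc := rfl

lemma prod_ofFn_bDegen (n : ℕ) (j : Fin (n + 1)) (g : BSimp G n) :
    (List.ofFn (bDegen n j g)).prod = (List.ofFn g).prod := by
  induction n with
  | zero => simp [bDegen, Fin.fin_one_eq_zero j]
  | succ n ih =>
    refine Fin.cases ?_ (fun j => ?_) j
    · have h : (fun k : Fin (n + 1) => bDegen (n + 1) 0 g k.succ) = g := by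
        funext k
        simp [bDegen]
      rw [List.ofFn_succ, h]
      simp [bDegen]
    · have h : (fun k : Fin (n + 1) => bDegen (n + 1) j.succ g k.succ) =
          bDegen n j (fun k => g k.succ) := by
        funext k
        simp only [bDegen, Fin.val_succ, add_lt_add_iff_right, add_left_inj]
        split_ifs
        · rfl
        · rfl
        · congr 1
          ext
          simp only [Fin.succ_mk]
          omega
      rw [List.ofFn_succ, h, List.prod_cons, ih, List.ofFn_succ (f := g), List.prod_cons]
      simp [bDegen]

lemma prod_ofFn_bFace_zero (n : ℕ) (g : BSimp G (n + 1)) :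
    g 0 * (List.ofFn (bFace n 0 g)).prod = (List.ofFn g).prod := by
  rw [List.ofFn_succ (f := g), List.prod_cons]
  rfl

lemma prod_ofFn_bFace (n : ℕ) (i : Fin n) (g : BSimp G (n + 1)) :
    (List.ofFn (bFace n i.succ.castSucc g)).prod = (List.ofFn g).prod := by
  induction n with
  | zero => exact i.elim0
  | succ n ih =>
    refine Fin.cases ?_ (fun i => ?_) i
    · have h : (fun k : Fin n => bFace (n + 1) (Fin.succ 0).castSucc g k.succ) =
          fun k => g k.succ.succ := by
        funext k
        simp [bFace]
      rw [List.ofFn_succ, h, List.ofFn_succ (f := g), List.ofFn_succ (n := n)]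
      simp [bFace, mul_assoc]
    · have h : (fun k : Fin n => bFace (n + 1) i.succ.succ.castSucc g k.succ) =
          bFace n i.succ.castSucc (fun k => g k.succ) := by
        funext k
        simp [bFace]
      rw [List.ofFn_succ, h, List.prod_cons, ih, List.ofFn_succ (f := g), List.prod_cons]
      simp [bFace]

/-- The tuple `(z (g₁ ⋯ g_n)⁻¹, g₁, …, g_n)`, which `bCyc` rotates. -/
def bCycExtend (z : G) (n : ℕ) (g : BSimp G n) : Fin (n + 1) → G :=
  Fin.cons (z * (List.ofFn g).prod⁻¹) g

lemma bCycExtend_bCyc {z : G} (hz : z ∈ Subgroup.center G) (n : ℕ) (g : BSimp G n)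
    (k : Fin (n + 1)) : bCycExtend z n (bCyc z n g) k = bCycExtend z n g (k - 1) := by
  cases n with
  | zero =>
    rw [Subsingleton.elim (bCyc z 0 g) g, Fin.fin_one_eq_zero k, Fin.fin_one_eq_zero (0 - 1)]
  | succ n =>
    refine Fin.cases ?_ (fun k => ?_) k
    · have h : (fun k : Fin n => bCyc z (n + 1) g k.succ) = fun k => g k.castSucc := by
        funext k
        rw [bCyc_succ]
      have hl : (0 - 1 : Fin (n + 2)) = (Fin.last n).succ := by
        rw [Fin.succ_last, sub_eq_iff_eq_add, Fin.last_add_one]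
      rw [hl, bCycExtend, bCycExtend, Fin.cons_zero, Fin.cons_succ, List.ofFn_succ, h,
        List.prod_cons]
      rw [bCyc_zero, List.ofFn_succ' (f := g), List.concat_eq_append, List.prod_append, List.prod_singleton]
      have hc := Subgroup.mem_center_iff.mp hz (g (Fin.last n))
      simp only [mul_inv_rev, inv_inv, mul_assoc, inv_mul_cancel, mul_one]
      rw [← mul_assoc, ← hc, mul_inv_cancel_right]
    · have hk : k.succ - 1 = k.castSucc := by
        rw [sub_eq_iff_eq_add, Fin.coeSucc_eq_succ]
      rw [hk, bCycExtend, bCycExtend, Fin.cons_succ]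
      refine Fin.cases ?_ (fun k => ?_) k
      · rfl
      · rw [← Fin.succ_castSucc, Fin.cons_succ, bCyc_succ]

lemma bCycExtend_iterate {z : G} (hz : z ∈ Subgroup.center G) (n m : ℕ) (g : BSimp G n)
    (k : Fin (n + 1)) :
    bCycExtend z n ((bCyc z n)^[m] g) k = bCycExtend z n g (k - Fin.ofNat (n + 1) m) := by
  induction m generalizing k with
  | zero =>
    rw [Function.iterate_zero_apply, Fin.ofNat_zero, sub_zero]
  | succ m ih =>
    rw [Function.iterate_succ_apply', bCycExtend_bCyc hz, ih, sub_sub]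
    congr 2
    ext
    simp [Fin.val_add, add_comm]

lemma bCyc_iterate {z : G} (hz : z ∈ Subgroup.center G) (n : ℕ) :
    (bCyc z n)^[n + 1] = (id : BSimp G n → BSimp G n) := by
  funext g k
  have h := bCycExtend_iterate hz n (n + 1) g k.succ
  rw [Fin.ofNat_self, sub_zero] at h
  simpa [bCycExtend] using h

lemma bFace_succ_comp_bCyc (z : G) (n : ℕ) (i : Fin (n + 1)) :
    bFace n i.succ ∘ bCyc z (n + 1) = bCyc z n ∘ bFace n i.castSucc := by
  funext g k
  simp only [Function.comp_apply]
  cases n with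
  | zero => exact k.elim0
  | succ n =>
  refine Fin.cases ?_ (fun k => ?_) k
  · refine Fin.cases ?_ (fun i => ?_) i
    · have h := prod_ofFn_bFace_zero (n + 1) g
      have hd : bFace (n + 1) (Fin.succ 0) (bCyc z (n + 1 + 1) g) 0 =
          bCyc z (n + 1 + 1) g 0 * g 0 := rfl
      rw [hd, bCyc_zero, bCyc_zero, ← h, mul_inv_rev, ← mul_assoc, inv_mul_cancel_right]
      rfl
    · rw [bCyc_zero, prod_ofFn_bFace, ← bCyc_zero]
      simp [bFace]
  · rw [bCyc_succ]
    simp only [bFace, Fin.val_succ, Fin.val_castSucc, ← Fin.succ_castSucc, bCyc_succ]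
    split_ifs <;> first
      | contradiction
      | omega
      | rfl

lemma bFace_zero_comp_bCyc (z : G) (n : ℕ) :
    bFace n 0 ∘ bCyc z (n + 1) = bFace n (Fin.last (n + 1)) := by
  funext g k
  simp [bFace, bCyc_succ]

lemma bDegen_succ_comp_bCyc (z : G) (n : ℕ) (i : Fin n) :
    bDegen n i.succ ∘ bCyc z n = bCyc z (n + 1) ∘ bDegen n i.castSucc := by
  funext g k
  simp only [Function.comp_apply]
  refine Fin.cases ?_ (fun k => ?_) k
  · rw [bCyc_zero, prod_ofFn_bDegen]
    simp [bDegen, bCyc, -List.ofFn_succ]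
  · rw [bCyc_succ]
    simp only [bDegen, bCyc, Fin.val_succ, Fin.val_castSucc]
    split_ifs <;> first
      | contradiction
      | omega
      | rfl

lemma bDegen_zero_comp_bCyc (z : G) (n : ℕ) :
    bDegen n 0 ∘ bCyc z n = (bCyc z (n + 1))^[2] ∘ bDegen n (Fin.last n) := by
  have h (g : BSimp G n) : bCyc z (n + 1) (bDegen n (Fin.last n) g) = bCycExtend z n g := by
    funext k
    refine Fin.cases ?_ (fun k => ?_) k
    · rw [bCyc_zero, prod_ofFn_bDegen]
      rfl
    · simp [bCyc_succ, bCycExtend, bDegen]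
  funext g k
  simp only [Function.comp_apply, Function.iterate_succ_apply, Function.iterate_zero_apply, h]
  refine Fin.cases ?_ (fun k => ?_) k
  · simp [bDegen, bCyc, bCycExtend, List.ofFn_succ]
  · rw [bCyc_succ]
    cases n with
    | zero => exact k.elim0
    | succ n =>
    refine Fin.cases ?_ (fun k => ?_) k
    · simp [bDegen, bCyc, bCycExtend]
    · rw [← Fin.succ_castSucc, bCycExtend, Fin.cons_succ]
      simp [bDegen, bCyc]
      rfl

/-- **The operators `t_n` make `B_•G` a cyclic set** (Loday, Example in §3):
for `z` in the center of `G`, the cyclic relations hold: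
`t_n^{n+1} = id`; `d_i t_n = t_{n-1} d_{i-1}` for `1 ≤ i ≤ n`; `d₀ t_n = d_n`;
`s_i t_n = t_{n+1} s_{i-1}` for `1 ≤ i ≤ n`; `s₀ t_n = t_{n+1}² s_n`.
(Faces on `B_{n+1}G` are indexed by `0 ≤ i ≤ n+1`, degeneracies on `B_nG`
by `0 ≤ j ≤ n`.) -/
theorem classifyingSpace_isCyclicSet (z : G) (hz : z ∈ Subgroup.center G) :
    -- `t_n^{n+1} = id` on `B_n G`
    (∀ n : ℕ, (bCyc z n)^[n + 1] = (id : BSimp G n → BSimp G n)) ∧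
    -- `d_i t_{n+1} = t_n d_{i-1}` for `1 ≤ i ≤ n+1` (faces of `B_{n+1}G`)
    (∀ n : ℕ, ∀ i : ℕ, ∀ h1 : 1 ≤ i, ∀ h2 : i ≤ n + 1,
      bFace n ⟨i, by omega⟩ ∘ bCyc z (n + 1)
        = bCyc z n ∘ bFace n ⟨i - 1, by omega⟩) ∧
    -- `d₀ t_{n+1} = d_{n+1}` (faces of `B_{n+1}G`)
    (∀ n : ℕ,
      bFace n (0 : Fin (n + 2)) ∘ bCyc z (n + 1)
        = bFace n ⟨n + 1, by omega⟩) ∧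
    -- `s_i t_n = t_{n+1} s_{i-1}` for `1 ≤ i ≤ n` (degeneracies of `B_nG`)
    (∀ n : ℕ, ∀ i : ℕ, ∀ h1 : 1 ≤ i, ∀ h2 : i ≤ n,
      bDegen n ⟨i, by omega⟩ ∘ bCyc z n
        = bCyc z (n + 1) ∘ bDegen n ⟨i - 1, by omega⟩) ∧
    -- `s₀ t_n = t_{n+1}² s_n` (degeneracies of `B_nG`)
    (∀ n : ℕ,
      bDegen n (0 : Fin (n + 1)) ∘ bCyc z n
        = (bCyc z (n + 1))^[2] ∘ bDegen n ⟨n, by omega⟩) := by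
  refine ⟨bCyc_iterate hz, fun n i h1 h2 => ?_, bFace_zero_comp_bCyc z, fun n i h1 h2 => ?_,
    bDegen_zero_comp_bCyc z⟩
  · obtain ⟨j, rfl⟩ := Nat.exists_eq_add_of_le' h1
    exact bFace_succ_comp_bCyc z n ⟨j, by omega⟩
  · obtain ⟨j, rfl⟩ := Nat.exists_eq_add_of_le' h1
    exact bDegen_succ_comp_bCyc z n ⟨j, by omega⟩
end
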